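/- Let A be a finite tree with b-coloring (B, R, G), and call an edge forbidden if it joins two vertices of B, or joins a vertex of B to an endpoint of an edge of R, or joins endpoints of (distinct) edges of R without itself being in R. Then no maximum matching of A contains a forbidden edge. -/

import Mathlib

variable {V : Type*} [Fintype V] [DecidableEq V]

/-- `C` is a vertex cover of `A`. -/
def IsVC (A : SimpleGraph V) (C : Set V) : Prop :=
  ∀ e ∈ A.edgeSet, ∃ v ∈ C, v ∈ e

/-- `C` is a minimum vertex cover of `A`. -/
def IsMinVC (A : SimpleGraph V) (C : Set V) : Prop :=
  IsVC A C ∧ ∀ D : Set V, IsVC A D → C.ncard ≤ D.ncard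

/-- `M` is a matching of `A`: a set of edges, pairwise non-adjacent. -/
def IsMatch (A : SimpleGraph V) (M : Set (Sym2 V)) : Prop :=
  M ⊆ A.edgeSet ∧ ∀ e ∈ M, ∀ f ∈ M, e ≠ f → ∀ v : V, ¬(v ∈ e ∧ v ∈ f)

/-- `M` is a maximum matching of `A`. -/
def IsMaxMatch (A : SimpleGraph V) (M : Set (Sym2 V)) : Prop :=
  IsMatch A M ∧ ∀ N : Set (Sym2 V), IsMatch A N → N.ncard ≤ M.ncard

/-- endpoints of a set of edges -/
def Rsupp (R : Set (Sym2 V)) : Set V := {v | ∃ e ∈ R, v ∈ e}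

/-- the tricoloring conditions (iii) of the paper -/
def IsBColoring (A : SimpleGraph V) (B : Set V) (R : Set (Sym2 V)) (G : Set V) : Prop :=
  R ⊆ A.edgeSet ∧
  B ∪ G ∪ Rsupp R = Set.univ ∧
  Disjoint B G ∧ Disjoint B (Rsupp R) ∧ Disjoint G (Rsupp R) ∧
  (∀ e ∈ R, ∀ f ∈ R, e ≠ f → ∀ v : V, ¬(v ∈ e ∧ v ∈ f)) ∧
  (∀ v w : V, A.Adj v w → v ∈ G → w ∈ B) ∧
  (∀ b ∈ B, 2 ≤ (A.neighborSet b ∩ G).ncard)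

/-- positive vertex-cover backbone -/
def PosBB (A : SimpleGraph V) : Set V := {v | ∀ C : Set V, IsMinVC A C → v ∈ C}

/-- negative vertex-cover backbone -/
def NegBB (A : SimpleGraph V) : Set V := {v | ∀ C : Set V, IsMinVC A C → v ∉ C}

/-- degenerate vertex -/
def Degen (A : SimpleGraph V) (v : V) : Prop :=
  (∃ C : Set V, IsMinVC A C ∧ v ∈ C) ∧ (∃ C : Set V, IsMinVC A C ∧ v ∉ C)

/-- exclusive edge -/
def Exclusive (A : SimpleGraph V) (e : Sym2 V) : Prop :=
  e ∈ A.edgeSet ∧ (∀ v ∈ e, Degen A v) ∧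
  ∀ C : Set V, IsMinVC A C → ∃ v ∈ e, v ∉ C

theorem aux_parent {W : Type*} (A : SimpleGraph W) (hA : A.IsTree) :
    ∃ p : W → W, ∀ v w, A.Adj v w → p v = w ∨ p w = v := by
  obtain ⟨r⟩ := hA.connected.nonempty
  choose f hf using fun v => (hA.existsUnique_path r v).exists
  refine ⟨fun v => (f v).penultimate, fun v w h => ?_⟩
  by_cases hv : v ∈ (f w).support
  · right
    exact (hA.isAcyclic.eq_penultimate_of_adj_end (hf w) h.symm hv).symm
  · left
    have := hA.isAcyclic.mem_support_of_ne_mem_support_of_adj_of_isPath (hf v) (hf w) h hv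
    exact (hA.isAcyclic.eq_penultimate_of_adj_end (hf v) h this).symm

theorem aux_color {W : Type*} (A : SimpleGraph W) (hA : A.IsTree) (a b : W) (hab : A.Adj a b) :
    ∃ c : W → Bool, c a = true ∧ c b = true ∧
      ∀ v w, A.Adj v w → s(v, w) ≠ s(a, b) → c v ≠ c w := by
  classical
  obtain ⟨c0⟩ := hA.colorable_two
  have hbr := SimpleGraph.isAcyclic_iff_forall_adj_isBridge.1 hA.isAcyclic hab
  rw [SimpleGraph.isBridge_iff] at hbr
  refine ⟨fun v => if (A.deleteEdges {s(a, b)}).Reachable a v then decide (c0 v = c0 a)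
    else decide (c0 v = c0 b), by simp, by simp [hbr], fun v w h hne => ?_⟩
  have hadj : (A.deleteEdges {s(a, b)}).Adj v w := by
    rw [SimpleGraph.deleteEdges_adj]
    exact ⟨h, by simpa using hne⟩
  have hr : (A.deleteEdges {s(a, b)}).Reachable a v ↔ (A.deleteEdges {s(a, b)}).Reachable a w :=
    ⟨fun x => x.trans hadj.reachable, fun x => x.trans hadj.symm.reachable⟩
  have h2 : ∀ x y z : Fin 2, x ≠ y → decide (x = z) ≠ decide (y = z) := by decide
  have hc := c0.valid h
  by_cases hv : (A.deleteEdges {s(a, b)}).Reachable a v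
  · have hw := hr.1 hv
    simp only [hv, hw, if_true]
    exact h2 _ _ _ hc
  · have hw : ¬ (A.deleteEdges {s(a, b)}).Reachable a w := fun x => hv (hr.2 x)
    simp only [hv, hw, if_false]
    exact h2 _ _ _ hc

theorem aux_lower (A : SimpleGraph V) (hA : A.IsTree)
    (B : Set V) (R : Set (Sym2 V)) (G : Set V) (hBC : IsBColoring A B R G) :
    ∃ N, IsMatch A N ∧ N.ncard = B.ncard + R.ncard := by
  obtain ⟨hR, -, hBG, hBR, hGR, hRm, -, hB2⟩ := hBC
  rw [Set.disjoint_left] at hBG hBR hGR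
  obtain ⟨p, hp⟩ := aux_parent A hA
  have : ∀ b, ∃ g, b ∈ B → A.Adj b g ∧ g ∈ G ∧ p g = b := by
    intro b
    by_cases hb : b ∈ B
    · obtain ⟨g, ⟨hg1, hg2⟩, hne⟩ := Set.exists_ne_of_one_lt_ncard (hB2 b hb) (p b)
      refine ⟨g, fun _ => ⟨hg1, hg2, ?_⟩⟩
      rcases hp b g hg1 with h | h
      · exact absurd h.symm hne
      · exact h
    · exact ⟨b, fun h => absurd h hb⟩
  choose f hf using this
  have key : ∀ b ∈ B, ∀ b' ∈ B, ∀ v, v ∈ s(b, f b) → v ∈ s(b', f b') → b = b' := by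
    intro b hb b' hb' v h1 h2
    obtain ⟨-, h3, h4⟩ := hf b hb
    obtain ⟨-, h5, h6⟩ := hf b' hb'
    rw [Sym2.mem_iff] at h1 h2
    rcases h1 with rfl | rfl <;> rcases h2 with h | h
    · exact h
    · exact absurd (h ▸ h5) (hBG hb)
    · exact absurd h3 (h ▸ hBG hb')
    · rw [← h4, ← h6, h]
  have key2 : ∀ b ∈ B, ∀ e ∈ R, ∀ v, v ∈ s(b, f b) → v ∉ e := by
    intro b hb e he v h1 h2
    rw [Sym2.mem_iff] at h1
    rcases h1 with rfl | rfl
    · exact hBR hb ⟨e, he, h2⟩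
    · exact hGR (hf b hb).2.1 ⟨e, he, h2⟩
  refine ⟨(fun b => s(b, f b)) '' B ∪ R, ⟨?_, ?_⟩, ?_⟩
  · rintro e (⟨b, hb, rfl⟩ | he)
    · exact (hf b hb).1
    · exact hR he
  · rintro e (⟨b, hb, rfl⟩ | he) e' (⟨b', hb', rfl⟩ | he') hne v ⟨h1, h2⟩
    · exact hne (by rw [key b hb b' hb' v h1 h2])
    · exact key2 b hb e' he' v h1 h2
    · exact key2 b' hb' e he v h2 h1
    · exact hRm e he e' he' hne v ⟨h1, h2⟩
  · rw [Set.ncard_union_eq _ (Set.toFinite _) (Set.toFinite _), Set.ncard_image_of_injOn]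
    · intro b hb b' hb' h
      have h' : s(b, f b) = s(b', f b') := h
      exact key b hb b' hb' b (Sym2.mem_mk_left _ _) (h' ▸ Sym2.mem_mk_left _ _)
    · rw [Set.disjoint_left]
      rintro e ⟨b, hb, rfl⟩ he
      exact key2 b hb _ he b (Sym2.mem_mk_left _ _) (Sym2.mem_mk_left _ _)

theorem aux_upper (A : SimpleGraph V) (hA : A.IsTree)
    (B : Set V) (R : Set (Sym2 V)) (G : Set V) (hBC : IsBColoring A B R G)
    (a b : V) (hab : A.Adj a b) (hnR : s(a, b) ∉ R)
    (ha : a ∈ B ∪ Rsupp R) (hb : b ∈ B ∪ Rsupp R)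
    (M : Set (Sym2 V)) (hM : IsMatch A M) (he : s(a, b) ∈ M) :
    M.ncard < B.ncard + R.ncard := by
  obtain ⟨hR, huniv, -, -, -, hRm, hGB, -⟩ := hBC
  obtain ⟨c, hca, hcb, hc⟩ := aux_color A hA a b hab
  set C' : Set V := {v | v ∈ Rsupp R ∧ c v = true} with hC'
  have haC : a ∈ B ∪ C' := ha.imp id fun h => ⟨h, hca⟩
  have hbC : b ∈ B ∪ C' := hb.imp id fun h => ⟨h, hcb⟩
  have hC'R : C'.ncard ≤ R.ncard := by
    have : ∀ v, ∃ e, v ∈ C' → e ∈ R ∧ v ∈ e := by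
      intro v
      by_cases hv : v ∈ C'
      · obtain ⟨⟨e, h1, h2⟩, -⟩ := hv
        exact ⟨e, fun _ => ⟨h1, h2⟩⟩
      · exact ⟨s(v, v), fun h => absurd h hv⟩
    choose g hg using this
    refine Set.ncard_le_ncard_of_injOn g (fun v hv => (hg v hv).1) ?_ (Set.toFinite _)
    intro v hv w hw h
    by_contra hne
    have h1 : g v = s(v, w) := (Sym2.mem_and_mem_iff hne).1 ⟨(hg v hv).2, h ▸ (hg w hw).2⟩
    have h2 : s(v, w) ∈ R := h1 ▸ (hg v hv).1
    refine hc v w (hR h2) (fun h3 => hnR (h3 ▸ h2)) ?_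
    rw [hv.2, hw.2]
  have hcov : ∀ v w, A.Adj v w → v ∈ B ∪ C' ∨ w ∈ B ∪ C' := by
    intro v w h
    by_cases hvw : s(v, w) = s(a, b)
    · rw [Sym2.eq_iff] at hvw
      rcases hvw with ⟨rfl, rfl⟩ | ⟨rfl, rfl⟩
      · exact Or.inl haC
      · exact Or.inl hbC
    have hv : v ∈ B ∪ G ∪ Rsupp R := huniv ▸ Set.mem_univ v
    have hw : w ∈ B ∪ G ∪ Rsupp R := huniv ▸ Set.mem_univ w
    rcases hv with (hv | hv) | hv
    · exact Or.inl (Or.inl hv)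
    · exact Or.inr (Or.inl (hGB v w h hv))
    rcases hw with (hw | hw) | hw
    · exact Or.inr (Or.inl hw)
    · exact Or.inl (Or.inl (hGB w v h.symm hw))
    have := hc v w h hvw
    cases hcv : c v
    · cases hcw : c w
      · exact absurd (hcv.trans hcw.symm) this
      · exact Or.inr (Or.inr ⟨hw, hcw⟩)
    · exact Or.inl (Or.inr ⟨hv, hcv⟩)
  have : ∀ e, ∃ v, e ∈ M → v ∈ (B ∪ C') \ {b} ∧ v ∈ e := by
    intro e
    by_cases heM : e ∈ M
    · by_cases h1 : e = s(a, b)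
      · exact ⟨a, fun _ => ⟨⟨haC, hab.ne⟩, h1 ▸ Sym2.mem_mk_left _ _⟩⟩
      · have hnb : b ∉ e := fun h => hM.2 e heM _ he h1 b ⟨h, Sym2.mem_mk_right _ _⟩
        have hex : ∃ v ∈ B ∪ C', v ∈ e := by
          have hA' := hM.1 heM
          induction e using Sym2.ind with
          | _ v w =>
            rcases hcov v w hA' with h | h
            · exact ⟨v, h, Sym2.mem_mk_left _ _⟩
            · exact ⟨w, h, Sym2.mem_mk_right _ _⟩
        obtain ⟨v, h2, h3⟩ := hex
        exact ⟨v, fun _ => ⟨⟨h2, fun h => hnb (h ▸ h3)⟩, h3⟩⟩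
    · exact ⟨b, fun h => absurd h heM⟩
  choose g hg using this
  have h1 : M.ncard ≤ ((B ∪ C') \ {b}).ncard := by
    refine Set.ncard_le_ncard_of_injOn g (fun e he => (hg e he).1) ?_ (Set.toFinite _)
    intro e he e' he' h
    by_contra hne
    exact hM.2 e he e' he' hne (g e) ⟨(hg e he).2, h ▸ (hg e' he').2⟩
  have h2 := Set.ncard_sdiff_singleton_lt_of_mem hbC (Set.toFinite _)
  have h3 := Set.ncard_union_le B C'
  omega

theorem no_forbidden_edge_in_max_matching (A : SimpleGraph V) (hA : A.IsTree)
    (B : Set V) (R : Set (Sym2 V)) (G : Set V) (hBC : IsBColoring A B R G)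
    (e : Sym2 V) (he : e ∈ A.edgeSet)
    (hforb : (∃ a b : V, e = s(a, b) ∧ a ∈ B ∧ b ∈ B) ∨
             (∃ a b : V, e = s(a, b) ∧ a ∈ B ∧ b ∈ Rsupp R) ∨
             (e ∉ R ∧ ∀ v ∈ e, v ∈ Rsupp R))
    (M : Set (Sym2 V)) (hM : IsMaxMatch A M) :
    e ∉ M := by 
  intro heM
  obtain ⟨N, hN, hNc⟩ := aux_lower A hA B R G hBC
  have hle := hM.2 N hN
  have hBR := Set.disjoint_left.1 hBC.2.2.2.1
  have main : ∀ a b : V, e = s(a, b) → e ∉ R → a ∈ B ∪ Rsupp R → b ∈ B ∪ Rsupp R → False := by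
    rintro a b rfl hn ha hb
    have := aux_upper A hA B R G hBC a b he hn ha hb M hM.1 heM
    omega
  rcases hforb with ⟨a, b, h, ha, hb⟩ | ⟨a, b, h, ha, hb⟩ | ⟨hn, hv⟩
  · exact main a b h (fun hr => hBR ha ⟨e, hr, h ▸ Sym2.mem_mk_left _ _⟩) (Or.inl ha) (Or.inl hb)
  · exact main a b h (fun hr => hBR ha ⟨e, hr, h ▸ Sym2.mem_mk_left _ _⟩) (Or.inl ha) (Or.inr hb)
  · induction e using Sym2.ind with
    | _ a b =>
      exact main a b rfl hn (Or.inr (hv a (Sym2.mem_mk_left _ _)))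
        (Or.inr (hv b (Sym2.mem_mk_right _ _)))
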